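/- Let d ∈ {2,3}, ε > 0, α > 1 and z ∈ ℝ^d. At every x with ε < |x| < αε, the vector field Ψ_{ε,α}[z] is differentiable and its Fréchet derivative satisfies the operator-norm bound ‖DΨ_{ε,α}[z](x)‖ ≤ 5 |z| / (|x| log α). -/

import Mathlib

/-- The radial cut-off profile `f_{A,B}`. -/
noncomputable def fAB (A B : ℝ) (z : ℝ) : ℝ :=
  if z < A then 1
  else if z ≤ B then (Real.log z - Real.log B) / (Real.log A - Real.log B)
  else 0

/-- The cut-off `η_{ε,α}(x) = f_{ε,αε}(|x|)` on `ℝ^d`. -/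
noncomputable def eta (d : ℕ) (ε α : ℝ) (x : EuclideanSpace ℝ (Fin d)) : ℝ :=
  fAB ε (α * ε) ‖x‖

/-- The auxiliary field `v_z(x) = (z₂x₃, z₃x₁, z₁x₂)` (1-based indices). -/
noncomputable def vz (z x : EuclideanSpace ℝ (Fin 3)) : EuclideanSpace ℝ (Fin 3) :=
  (WithLp.equiv 2 (Fin 3 → ℝ)).symm ![z 1 * x 2, z 2 * x 0, z 0 * x 1]

/-- Cross product of two vectors of `ℝ³`. -/
noncomputable def cross3 (a b : EuclideanSpace ℝ (Fin 3)) : EuclideanSpace ℝ (Fin 3) :=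
  (WithLp.equiv 2 (Fin 3 → ℝ)).symm
    ![a 1 * b 2 - a 2 * b 1, a 2 * b 0 - a 0 * b 2, a 0 * b 1 - a 1 * b 0]

/-- The gradient `∇η_{ε,α}(x) = -x/(|x|² log α)` on the annulus. -/
noncomputable def gradEta3 (α : ℝ) (x : EuclideanSpace ℝ (Fin 3)) : EuclideanSpace ℝ (Fin 3) :=
  -(1 / (‖x‖ ^ 2 * Real.log α)) • x

/-- The divergence-free cut-off field `Ψ_{ε,α}[z]` in dimension 3:
equal to `z` for `|x| ≤ ε`, to `η_{ε,α} z + ∇η_{ε,α} × v_z` for `ε < |x| < αε`,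
and to `0` for `|x| ≥ αε`. -/
noncomputable def Psi3 (ε α : ℝ) (z x : EuclideanSpace ℝ (Fin 3)) : EuclideanSpace ℝ (Fin 3) :=
  if ‖x‖ ≤ ε then z
  else if ‖x‖ < α * ε then eta 3 ε α x • z + cross3 (gradEta3 α x) (vz z x)
  else 0

/-- Curl of a vector field on `ℝ³`, via Fréchet derivatives in coordinate directions. -/
noncomputable def curl3 (F : EuclideanSpace ℝ (Fin 3) → EuclideanSpace ℝ (Fin 3))
    (x : EuclideanSpace ℝ (Fin 3)) : EuclideanSpace ℝ (Fin 3) :=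
  (WithLp.equiv 2 (Fin 3 → ℝ)).symm
    ![fderiv ℝ F x (EuclideanSpace.single 1 1) 2 - fderiv ℝ F x (EuclideanSpace.single 2 1) 1,
      fderiv ℝ F x (EuclideanSpace.single 2 1) 0 - fderiv ℝ F x (EuclideanSpace.single 0 1) 2,
      fderiv ℝ F x (EuclideanSpace.single 0 1) 1 - fderiv ℝ F x (EuclideanSpace.single 1 1) 0]

/-- Divergence of a vector field on `ℝ³`. -/
noncomputable def div3 (F : EuclideanSpace ℝ (Fin 3) → EuclideanSpace ℝ (Fin 3))
    (x : EuclideanSpace ℝ (Fin 3)) : ℝ :=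
  ∑ i, fderiv ℝ F x (EuclideanSpace.single i 1) i
/-- The scalar field `g_z(x) = z₂x₁ − z₁x₂` (1-based indices). -/
noncomputable def gz (z x : EuclideanSpace ℝ (Fin 2)) : ℝ := z 1 * x 0 - z 0 * x 1

/-- The perpendicular gradient `∇⊥h = (-∂₂h, ∂₁h)` of a scalar field on `ℝ²`. -/
noncomputable def perpGrad (h : EuclideanSpace ℝ (Fin 2) → ℝ) (x : EuclideanSpace ℝ (Fin 2)) :
    EuclideanSpace ℝ (Fin 2) :=
  (WithLp.equiv 2 (Fin 2 → ℝ)).symm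
    ![-(fderiv ℝ h x (EuclideanSpace.single 1 1)), fderiv ℝ h x (EuclideanSpace.single 0 1)]

/-- `∇⊥η_{ε,α}(x)` on the annulus, computed from `∇η_{ε,α}(x) = -x/(|x|² log α)`. -/
noncomputable def perpGradEta2 (α : ℝ) (x : EuclideanSpace ℝ (Fin 2)) :
    EuclideanSpace ℝ (Fin 2) :=
  (WithLp.equiv 2 (Fin 2 → ℝ)).symm
    ![x 1 / (‖x‖ ^ 2 * Real.log α), -(x 0) / (‖x‖ ^ 2 * Real.log α)]

/-- The divergence-free cut-off field `Ψ_{ε,α}[z]` in dimension 2: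
equal to `z` for `|x| ≤ ε`, to `η_{ε,α} z + g_z ∇⊥η_{ε,α}` for `ε < |x| < αε`,
and to `0` for `|x| ≥ αε`. -/
noncomputable def Psi2 (ε α : ℝ) (z x : EuclideanSpace ℝ (Fin 2)) : EuclideanSpace ℝ (Fin 2) :=
  if ‖x‖ ≤ ε then z
  else if ‖x‖ < α * ε then eta 2 ε α x • z + gz z x • perpGradEta2 α x
  else 0

/-- Divergence of a vector field on `ℝ²`. -/
noncomputable def div2 (F : EuclideanSpace ℝ (Fin 2) → EuclideanSpace ℝ (Fin 2))
    (x : EuclideanSpace ℝ (Fin 2)) : ℝ :=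
  ∑ i, fderiv ℝ F x (EuclideanSpace.single i 1) i


lemma generic_bound {E : Type*} [NormedAddCommGroup E] [InnerProductSpace ℝ E]
    (z x : E) (hx : x ≠ 0) (L K : ℝ) (hL : 0 < L) (B : E →ₗ[ℝ] E →ₗ[ℝ] E)
    (hB : ∀ a b, ‖B a b‖ ≤ ‖z‖ * ‖a‖ * ‖b‖) (ψ : E → E)
    (hψ : ∀ᶠ y in nhds x,
      ψ y = (-L⁻¹) • ((Real.log ‖y‖ - K) • z + (‖y‖ ^ 2)⁻¹ • B y y)) :
    DifferentiableAt ℝ ψ x ∧ ‖fderiv ℝ ψ x‖ ≤ 5 * ‖z‖ / (‖x‖ * L) := by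
  have hr : 0 < ‖x‖ := norm_pos_iff.mpr hx
  have hr2 : ‖x‖ ^ 2 ≠ 0 := by positivity
  set C : E →L[ℝ] E →L[ℝ] E := B.mkContinuous₂ ‖z‖ hB with hC
  have hCB : ∀ a b, C a b = B a b := fun a b => rfl
  have h1 : HasFDerivAt (fun y : E => ‖y‖ ^ 2) (2 • innerSL ℝ x) x :=
    (hasStrictFDerivAt_norm_sq x).hasFDerivAt
  have h2 : HasFDerivAt (fun y : E => Real.log ‖y‖ - K)
      ((1 / 2 : ℝ) • ((‖x‖ ^ 2)⁻¹ • (2 • innerSL ℝ x))) x := by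
    have := ((h1.log hr2).const_mul (1 / 2 : ℝ)).sub_const K
    refine this.congr_of_eventuallyEq (Filter.Eventually.of_forall fun y => ?_)
    simp only [Real.log_pow]
    push_cast
    ring
  have h3 : HasFDerivAt (fun y : E => (‖y‖ ^ 2)⁻¹) (-((‖x‖ ^ 2) ^ 2)⁻¹ • (2 • innerSL ℝ x)) x :=
    (hasDerivAt_inv hr2).comp_hasFDerivAt x h1
  have h4 : HasFDerivAt (fun y : E => C y y) (C x + C.flip x) x := by
    have := C.hasFDerivAt_of_bilinear (hasFDerivAt_id x) (hasFDerivAt_id x)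
    refine this.congr_fderiv ?_
    ext h
    simp
  have h5 := (((h2.smul_const z).add (h3.smul h4)).const_smul (-L⁻¹)).congr_of_eventuallyEq
    (f₁ := ψ) (by
      filter_upwards [hψ] with y hy
      rw [hy]; rfl)
  refine ⟨h5.differentiableAt, ?_⟩
  rw [h5.fderiv]
  refine ContinuousLinearMap.opNorm_le_bound _ (by positivity) fun h => ?_
  have hin : |inner ℝ x h| ≤ ‖x‖ * ‖h‖ := abs_real_inner_le_norm x h
  have key : ‖(inner ℝ x h / ‖x‖ ^ 2) • z + ((‖x‖ ^ 2)⁻¹ • (B x h + B h x)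
      - (2 * inner ℝ x h / (‖x‖ ^ 2) ^ 2) • B x x)‖ ≤ 5 * ‖z‖ * ‖h‖ / ‖x‖ := by
    have e1 : ‖(inner ℝ x h / ‖x‖ ^ 2) • z‖ ≤ ‖z‖ * ‖h‖ / ‖x‖ := by
      rw [norm_smul, Real.norm_eq_abs, abs_div, abs_of_pos (show 0 < ‖x‖ ^ 2 by positivity)]
      calc _ ≤ (‖x‖ * ‖h‖) / ‖x‖ ^ 2 * ‖z‖ := by gcongr
        _ = _ := by field_simp
    have e2 : ‖(‖x‖ ^ 2)⁻¹ • (B x h + B h x)‖ ≤ 2 * ‖z‖ * ‖h‖ / ‖x‖ := by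
      rw [norm_smul, Real.norm_eq_abs, abs_of_pos (show 0 < (‖x‖ ^ 2)⁻¹ by positivity)]
      calc _ ≤ (‖x‖ ^ 2)⁻¹ * (‖z‖ * ‖x‖ * ‖h‖ + ‖z‖ * ‖h‖ * ‖x‖) := by
            gcongr
            exact (norm_add_le _ _).trans (add_le_add (hB _ _) (hB _ _))
        _ = _ := by field_simp; ring
    have e3 : ‖(2 * inner ℝ x h / (‖x‖ ^ 2) ^ 2) • B x x‖ ≤ 2 * ‖z‖ * ‖h‖ / ‖x‖ := by
      rw [norm_smul, Real.norm_eq_abs, abs_div, abs_mul, abs_two,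
        abs_of_pos (show 0 < (‖x‖ ^ 2) ^ 2 by positivity)]
      calc _ ≤ (2 * (‖x‖ * ‖h‖)) / (‖x‖ ^ 2) ^ 2 * (‖z‖ * ‖x‖ * ‖x‖) := by
            gcongr
            exact hB _ _
        _ = _ := by field_simp
    calc _ ≤ ‖z‖ * ‖h‖ / ‖x‖ + (2 * ‖z‖ * ‖h‖ / ‖x‖ + 2 * ‖z‖ * ‖h‖ / ‖x‖) :=
          (norm_add_le _ _).trans (add_le_add e1 ((norm_sub_le _ _).trans (add_le_add e2 e3)))
      _ = _ := by ring
  have hval : ∀ w w' : E, w = (-L⁻¹) • w' → ‖w'‖ ≤ 5 * ‖z‖ * ‖h‖ / ‖x‖ →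
      ‖w‖ ≤ 5 * ‖z‖ / (‖x‖ * L) * ‖h‖ := by
    rintro w w' rfl hw
    rw [norm_smul, norm_neg, Real.norm_eq_abs, abs_of_pos (by positivity)]
    calc _ ≤ L⁻¹ * (5 * ‖z‖ * ‖h‖ / ‖x‖) := by gcongr
      _ = _ := by field_simp
  refine hval _ _ ?_ key
  simp [hCB]
  module

lemma cross3_norm_le (a b : EuclideanSpace ℝ (Fin 3)) : ‖cross3 a b‖ ≤ ‖a‖ * ‖b‖ := by
  refine le_of_sq_le_sq ?_ (by positivity)
  rw [mul_pow, EuclideanSpace.real_norm_sq_eq, EuclideanSpace.real_norm_sq_eq,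
    EuclideanSpace.real_norm_sq_eq]
  simp [cross3, Fin.sum_univ_three]
  nlinarith [sq_nonneg (a 0 * b 0 + a 1 * b 1 + a 2 * b 2)]

lemma vz_norm_le (a b : EuclideanSpace ℝ (Fin 3)) : ‖vz a b‖ ≤ ‖a‖ * ‖b‖ := by
  refine le_of_sq_le_sq ?_ (by positivity)
  rw [mul_pow, EuclideanSpace.real_norm_sq_eq, EuclideanSpace.real_norm_sq_eq,
    EuclideanSpace.real_norm_sq_eq]
  simp [vz, Fin.sum_univ_three]
  nlinarith [sq_nonneg (a 0 * b 0), sq_nonneg (a 0 * b 2), sq_nonneg (a 1 * b 0),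
    sq_nonneg (a 1 * b 1), sq_nonneg (a 2 * b 1), sq_nonneg (a 2 * b 2)]

/-- Rotation by a quarter turn. -/
noncomputable def rot2 (b : EuclideanSpace ℝ (Fin 2)) : EuclideanSpace ℝ (Fin 2) :=
  (WithLp.equiv 2 (Fin 2 → ℝ)).symm ![-b 1, b 0]

lemma rot2_norm (b : EuclideanSpace ℝ (Fin 2)) : ‖rot2 b‖ = ‖b‖ := by
  rw [← sq_eq_sq₀ (by positivity) (by positivity), EuclideanSpace.real_norm_sq_eq,
    EuclideanSpace.real_norm_sq_eq]
  simp [rot2, Fin.sum_univ_two]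
  ring

lemma gz_le (a b : EuclideanSpace ℝ (Fin 2)) : |gz a b| ≤ ‖a‖ * ‖b‖ := by
  refine le_of_sq_le_sq ?_ (by positivity)
  rw [mul_pow, EuclideanSpace.real_norm_sq_eq, EuclideanSpace.real_norm_sq_eq]
  simp [gz, Fin.sum_univ_two]
  nlinarith [sq_nonneg (a 0 * b 0 + a 1 * b 1)]

noncomputable def B3 (z : EuclideanSpace ℝ (Fin 3)) :
    EuclideanSpace ℝ (Fin 3) →ₗ[ℝ] EuclideanSpace ℝ (Fin 3) →ₗ[ℝ] EuclideanSpace ℝ (Fin 3) :=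
  LinearMap.mk₂ ℝ (fun a b => cross3 a (vz z b))
    (by intro a a' b; ext i; fin_cases i <;> simp [cross3, vz] <;> ring)
    (by intro c a b; ext i; fin_cases i <;> simp [cross3, vz] <;> ring)
    (by intro a b b'; ext i; fin_cases i <;> simp [cross3, vz] <;> ring)
    (by intro c a b; ext i; fin_cases i <;> simp [cross3, vz] <;> ring)

noncomputable def B2 (z : EuclideanSpace ℝ (Fin 2)) :
    EuclideanSpace ℝ (Fin 2) →ₗ[ℝ] EuclideanSpace ℝ (Fin 2) →ₗ[ℝ] EuclideanSpace ℝ (Fin 2) :=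
  LinearMap.mk₂ ℝ (fun a b => gz z a • rot2 b)
    (by intro a a' b; ext i; fin_cases i <;> simp [gz, rot2] <;> ring)
    (by intro c a b; ext i; fin_cases i <;> simp [gz, rot2] <;> ring)
    (by intro a b b'; ext i; fin_cases i <;> simp [gz, rot2] <;> ring)
    (by intro c a b; ext i; fin_cases i <;> simp [gz, rot2] <;> ring)

lemma annulus_eventually {d : ℕ} (ε R : ℝ) (x : EuclideanSpace ℝ (Fin d)) (h1 : ε < ‖x‖)
    (h2 : ‖x‖ < R) : ∀ᶠ y in nhds x, ε < ‖y‖ ∧ ‖y‖ < R :=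
  (continuous_norm.continuousAt.eventually (lt_mem_nhds h1)).and
    (continuous_norm.continuousAt.eventually (gt_mem_nhds h2))

lemma eta_eq {d : ℕ} (ε α : ℝ) (hε : 0 < ε) (hα : 1 < α) (y : EuclideanSpace ℝ (Fin d))
    (h1 : ε < ‖y‖) (h2 : ‖y‖ < α * ε) :
    eta d ε α y = -(Real.log α)⁻¹ * (Real.log ‖y‖ - Real.log (α * ε)) := by
  have hL := Real.log_pos hα
  unfold eta fAB
  rw [if_neg (by linarith), if_pos h2.le]
  have : Real.log ε - Real.log (α * ε) = - Real.log α := by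
    rw [Real.log_mul (by linarith) hε.ne']; ring
  rw [this, div_neg, div_eq_inv_mul]; ring

/-- For `d ∈ {2,3}`, on the annulus `ε < |x| < αε` the field `Ψ_{ε,α}[z]` is differentiable
with `‖DΨ_{ε,α}[z](x)‖ ≤ 5|z|/(|x| log α)` (operator norm). -/
theorem Psi_deriv_pointwise_bound (ε α : ℝ) (hε : 0 < ε) (hα : 1 < α) :
    (∀ (z x : EuclideanSpace ℝ (Fin 2)), ε < ‖x‖ → ‖x‖ < α * ε →
      DifferentiableAt ℝ (Psi2 ε α z) x ∧
      ‖fderiv ℝ (Psi2 ε α z) x‖ ≤ 5 * ‖z‖ / (‖x‖ * Real.log α)) ∧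
    (∀ (z x : EuclideanSpace ℝ (Fin 3)), ε < ‖x‖ → ‖x‖ < α * ε →
      DifferentiableAt ℝ (Psi3 ε α z) x ∧
      ‖fderiv ℝ (Psi3 ε α z) x‖ ≤ 5 * ‖z‖ / (‖x‖ * Real.log α)) := by
  have hL := Real.log_pos hα
  constructor
  · intro z x h1 h2
    refine generic_bound z x (norm_pos_iff.mp (hε.trans h1)) _ (Real.log (α * ε)) hL (B2 z)
      (fun a b => ?_) _ ?_
    · change ‖gz z a • rot2 b‖ ≤ _
      rw [norm_smul, rot2_norm, Real.norm_eq_abs]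
      gcongr
      exact gz_le z a
    · filter_upwards [annulus_eventually ε (α * ε) x h1 h2] with y hy
      have hy0 : ‖y‖ ≠ 0 := (hε.trans hy.1).ne'
      rw [Psi2, if_neg (not_le.mpr hy.1), if_pos hy.2, eta_eq ε α hε hα y hy.1 hy.2]
      change _ = _ • (_ + _ • (gz z y • rot2 y))
      ext i
      fin_cases i <;> simp [rot2, perpGradEta2] <;> field_simp <;> ring
  · intro z x h1 h2
    refine generic_bound z x (norm_pos_iff.mp (hε.trans h1)) _ (Real.log (α * ε)) hL (B3 z)
      (fun a b => ?_) _ ?_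
    · change ‖cross3 a (vz z b)‖ ≤ _
      calc _ ≤ ‖a‖ * ‖vz z b‖ := cross3_norm_le _ _
        _ ≤ ‖a‖ * (‖z‖ * ‖b‖) := by gcongr; exact vz_norm_le z b
        _ = _ := by ring
    · filter_upwards [annulus_eventually ε (α * ε) x h1 h2] with y hy
      have hy0 : ‖y‖ ≠ 0 := (hε.trans hy.1).ne'
      rw [Psi3, if_neg (not_le.mpr hy.1), if_pos hy.2, eta_eq ε α hε hα y hy.1 hy.2]
      change _ = _ • (_ + _ • (cross3 y (vz z y)))
      ext i
      fin_cases i <;> simp [cross3, gradEta3] <;> field_simp <;> ring
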